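/- For every ε > 0, the entropy function E(σ) = −log( σ(1−σ) + ε ) is well defined and convex on the interval [0,1]; that is, σ(1−σ) + ε > 0 for all σ ∈ [0,1], and E restricted to [0,1] is a convex function. -/

import Mathlib

/-- The logarithm of a positive concave function is concave. -/
theorem ConcaveOn.log_of_pos {E : Type*} [AddCommMonoid E] [Module ℝ E] {s : Set E} {f : E → ℝ}
    (hf : ConcaveOn ℝ s f) (hpos : ∀ x ∈ s, 0 < f x) :
    ConcaveOn ℝ s (fun x => Real.log (f x)) := by
  refine ⟨hf.1, fun x hx y hy a b ha hb hab => ?_⟩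
  have hlog := strictConcaveOn_log_Ioi.concaveOn
  exact (hlog.2 (hpos x hx) (hpos y hy) ha hb hab).trans <|
    Real.log_le_log (hlog.1 (hpos x hx) (hpos y hy) ha hb hab) (hf.2 hx hy ha hb hab)

theorem concaveOn_mul_one_sub_add_const {s : Set ℝ} (hs : Convex ℝ s) (c : ℝ) :
    ConcaveOn ℝ s (fun x : ℝ => x * (1 - x) + c) := by
  refine ⟨hs, fun x _ y _ a b ha hb hab => ?_⟩
  obtain rfl : b = 1 - a := by linarith
  simp only [smul_eq_mul]
  nlinarith [mul_nonneg (mul_nonneg ha hb) (sq_nonneg (x - y))]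

/-- For every `ε > 0`, the entropy function `E(σ) = −log(σ(1−σ) + ε)` is well
defined and convex on `[0,1]`: the argument of the logarithm is positive there,
and `E` restricted to `[0,1]` is convex. -/
theorem entropy_log_convex (ε : ℝ) (hε : 0 < ε) :
    (∀ σ ∈ Set.Icc (0:ℝ) 1, 0 < σ * (1 - σ) + ε) ∧
    ConvexOn ℝ (Set.Icc (0:ℝ) 1) (fun σ : ℝ => -Real.log (σ * (1 - σ) + ε)) := by
  have hpos : ∀ σ ∈ Set.Icc (0:ℝ) 1, 0 < σ * (1 - σ) + ε := fun σ hσ =>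
    add_pos_of_nonneg_of_pos (mul_nonneg hσ.1 (sub_nonneg.2 hσ.2)) hε
  exact ⟨hpos, ((concaveOn_mul_one_sub_add_const (convex_Icc 0 1) ε).log_of_pos hpos).neg⟩
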